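/- Let $I \subseteq \mathbb{R}$ be an open interval and $f : I \to (0,\infty)$ a smooth function with $(\log f)''(t) \le 0$ for all $t \in I$. Then there is no smooth doubly periodic function $u : \mathbb{R}^2 \to \mathbb{R}$ with $u(\mathbb{R}^2) \subseteq I$, $|Du| < f(u)$ everywhere, and $H(u)^2 < \dfrac{f'(u)^2}{f(u)^2}$ at every point of $\mathbb{R}^2$. -/

import Mathlib

noncomputable section

/-- The Euclidean plane. -/
abbrev E2 : Type := EuclideanSpace ℝ (Fin 2)

/-- Euclidean divergence of a vector field on the plane: the trace of its derivative. -/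
def divergence (V : E2 → E2) (p : E2) : ℝ :=
  LinearMap.trace ℝ E2 (fderiv ℝ V p).toLinearMap

/-- The mean curvature operator `H(u)` of the spacelike graph of `u` in the GRW spacetime
`I ×_f ℝ²`:
`H(u) = - div (Du / (2 f(u) √(f(u)² - |Du|²))) - (f'(u) / (2 √(f(u)² - |Du|²))) (2 + |Du|²/f(u)²)`. -/
def Hmean (f : ℝ → ℝ) (u : E2 → ℝ) (p : E2) : ℝ :=
  - divergence
      (fun q => (2 * f (u q) * Real.sqrt ((f (u q)) ^ 2 - ‖gradient u q‖ ^ 2))⁻¹ • gradient u q) p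
  - deriv f (u p) / (2 * Real.sqrt ((f (u p)) ^ 2 - ‖gradient u p‖ ^ 2)) *
      (2 + ‖gradient u p‖ ^ 2 / (f (u p)) ^ 2)

/-- A function on the plane is doubly periodic if it is invariant under translation by
every vector of `ℤ²`. -/
def DoublyPeriodic (u : E2 → ℝ) : Prop :=
  ∀ p : E2, ∀ k : Fin 2 → ℤ,
    u (p + (WithLp.equiv 2 (Fin 2 → ℝ)).symm (fun i => (k i : ℝ))) = u p

end

open Filter Topology in
lemma aux_second {h : ℝ → ℝ} (hh : ContDiff ℝ (⊤ : ℕ∞) h) (hmin : ∀ t, h 0 ≤ h t) :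
    0 ≤ deriv (deriv h) 0 := by
  by_contra hneg
  push Not at hneg
  have h0 : deriv h 0 = 0 := IsLocalMin.deriv_eq_zero (Eventually.of_forall hmin)
  have hmax : IsLocalMax h 0 :=
    isLocalMax_of_deriv_deriv_neg hneg h0 hh.continuous.continuousAt
  have he : h =ᶠ[𝓝 0] fun _ => h 0 := by
    filter_upwards [hmax] with t ht using le_antisymm ht (hmin t)
  have h2 : deriv (deriv h) 0 = 0 := by
    rw [he.deriv.deriv_eq]; simp
  linarith

lemma grad_contDiff {u : E2 → ℝ} (hu : ContDiff ℝ (⊤ : ℕ∞) u) :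
    ContDiff ℝ (⊤ : ℕ∞) (gradient u) := by
  have h1 : ContDiff ℝ (⊤ : ℕ∞) (fderiv ℝ u) := hu.fderiv_right (by simp)
  exact (InnerProductSpace.toDual ℝ E2).symm.toContinuousLinearEquiv.contDiff.comp h1

lemma inner_grad {u : E2 → ℝ} (p v : E2) : inner ℝ v (gradient u p) = fderiv ℝ u p v := by
  rw [real_inner_comm, gradient, InnerProductSpace.toDual_symm_apply]

lemma aux_quad {u : E2 → ℝ} (hu : ContDiff ℝ (⊤ : ℕ∞) u) (p : E2) (hmin : ∀ q, u p ≤ u q)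
    (v : E2) : 0 ≤ inner ℝ v (fderiv ℝ (gradient u) p v) := by
  have hline : ∀ t : ℝ, HasDerivAt (fun t : ℝ => p + t • v) v t := by
    intro t
    simpa using ((hasDerivAt_id t).smul_const v).const_add p
  have hd : ∀ t : ℝ, HasDerivAt (fun t : ℝ => u (p + t • v)) (inner ℝ v (gradient u (p + t • v))) t := by
    intro t
    rw [inner_grad]
    have := (hu.differentiable (by simp) (p + t • v)).hasFDerivAt
    exact this.comp_hasDerivAt t (hline t)
  have hd2 : HasDerivAt (fun t : ℝ => inner ℝ v (gradient u (p + t • v)))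
      (inner ℝ v (fderiv ℝ (gradient u) p v)) 0 := by
    have h1 := ((grad_contDiff hu).differentiable (by simp) (p + (0:ℝ) • v)).hasFDerivAt
    have h2 := h1.comp_hasDerivAt (0:ℝ) (hline 0)
    have h3 := (hasDerivAt_const (0:ℝ) v).inner ℝ h2
    simpa using h3
  have hs : ContDiff ℝ (⊤ : ℕ∞) (fun t : ℝ => u (p + t • v)) :=
    hu.comp (contDiff_const.add (contDiff_id.smul contDiff_const))
  have := aux_second hs (by intro t; simpa using hmin _)
  rw [show deriv (fun t : ℝ => u (p + t • v)) = _ from funext fun t => (hd t).deriv, hd2.deriv] at this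
  exact this

lemma trace_eq (L : E2 →ₗ[ℝ] E2) : LinearMap.trace ℝ E2 L =
    ∑ i, inner ℝ (EuclideanSpace.basisFun (Fin 2) ℝ i) (L (EuclideanSpace.basisFun (Fin 2) ℝ i)) :=
  LinearMap.trace_eq_sum_inner L (EuclideanSpace.basisFun (Fin 2) ℝ)

lemma div_nonneg_of_min {u : E2 → ℝ} (hu : ContDiff ℝ (⊤ : ℕ∞) u) (p : E2)
    (hmin : ∀ q, u p ≤ u q) : 0 ≤ divergence (gradient u) p := by
  rw [divergence, trace_eq]
  exact Finset.sum_nonneg fun i _ => aux_quad hu p hmin _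

lemma grad_neg (u : E2 → ℝ) : gradient (fun q => - u q) = fun q => - gradient u q := by
  funext q
  simp only [gradient]
  rw [fderiv_fun_neg, map_neg]

lemma div_nonpos_of_max {u : E2 → ℝ} (hu : ContDiff ℝ (⊤ : ℕ∞) u) (p : E2)
    (hmax : ∀ q, u q ≤ u p) : divergence (gradient u) p ≤ 0 := by
  have h := div_nonneg_of_min (u := fun q => - u q) hu.neg p (fun q => neg_le_neg (hmax q))
  rw [grad_neg] at h
  unfold divergence at h ⊢
  rw [fderiv_fun_neg] at h
  simp only [ContinuousLinearMap.toLinearMap_neg, map_neg] at h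
  linarith

lemma Hmean_crit {f : ℝ → ℝ} {u : E2 → ℝ} (hu : ContDiff ℝ (⊤ : ℕ∞) u) (p : E2)
    (hf : DifferentiableAt ℝ f (u p)) (hpos : 0 < f (u p)) (hg : gradient u p = 0) :
    Hmean f u p = - (divergence (gradient u) p / (2 * f (u p) ^ 2)) - deriv f (u p) / f (u p) := by
  have hG : DifferentiableAt ℝ (gradient u) p := (grad_contDiff hu).differentiable (by simp) p
  have hfu : DifferentiableAt ℝ (fun q => f (u q)) p :=
    DifferentiableAt.comp p hf (hu.differentiable (by simp) p)
  have hs : DifferentiableAt ℝ (fun q => f (u q) ^ 2 - ‖gradient u q‖ ^ 2) p :=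
    (hfu.pow 2).sub (hG.norm_sq ℝ)
  have hc : DifferentiableAt ℝ
      (fun q => (2 * f (u q) * Real.sqrt ((f (u q)) ^ 2 - ‖gradient u q‖ ^ 2))⁻¹) p := by
    refine DifferentiableAt.fun_inv ((hfu.const_mul 2).mul (hs.sqrt ?_)) ?_
    · rw [hg]; simp; positivity
    · rw [hg]; simp [Real.sqrt_sq hpos.le, hpos.ne']
  unfold Hmean divergence
  rw [fderiv_fun_smul hc hG]
  simp only [hg, norm_zero]
  have e : Real.sqrt (f (u p) ^ 2 - 0 ^ 2) = f (u p) := by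
    simp [Real.sqrt_sq hpos.le]
  rw [e]
  simp
  field_simp

lemma exists_ext {u : E2 → ℝ} (hu : Continuous u) (hp : DoublyPeriodic u) :
    (∃ p, ∀ q, u p ≤ u q) ∧ ∃ p, ∀ q, u q ≤ u p := by
  let K : Set E2 := (WithLp.toLp 2) '' (Set.pi Set.univ fun _ : Fin 2 => Set.Icc (0:ℝ) 1)
  have hK : IsCompact K :=
    (isCompact_univ_pi fun _ => isCompact_Icc).image (PiLp.continuous_toLp 2 _)
  have hne : K.Nonempty := ⟨_, 0, fun _ _ => ⟨le_refl _, zero_le_one⟩, rfl⟩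
  have hrep : ∀ q, ∃ r ∈ K, u r = u q := by
    intro q
    refine ⟨_, ⟨fun i => Int.fract (q i), ?_, rfl⟩, ?_⟩
    · intro i _
      exact ⟨Int.fract_nonneg _, (Int.fract_lt_one _).le⟩
    · rw [← hp q (fun i => - ⌊q i⌋)]
      congr 1
      ext i
      simp [Int.fract, sub_eq_add_neg]
  obtain ⟨p, -, h1⟩ := hK.exists_isMinOn hne hu.continuousOn
  obtain ⟨p', -, h2⟩ := hK.exists_isMaxOn hne hu.continuousOn
  refine ⟨⟨p, fun q => ?_⟩, ⟨p', fun q => ?_⟩⟩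
  · obtain ⟨r, hr, e⟩ := hrep q
    rw [← e]; exact h1 hr
  · obtain ⟨r, hr, e⟩ := hrep q
    rw [← e]; exact h2 hr

/-- Calabi–Bernstein nonexistence (Theorem 4.1, second part) on the flat torus:
if `(log f)'' ≤ 0` on `I`, there is no smooth doubly periodic function `u` with
`|Du| < f(u)` and `H(u)² < f'(u)²/f(u)²` everywhere. -/
theorem stmt4 (I : Set ℝ) (hI : IsOpen I) (hIc : I.OrdConnected)
    (f : ℝ → ℝ) (hf : ContDiffOn ℝ (⊤ : ℕ∞) f I) (hfpos : ∀ t ∈ I, 0 < f t)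
    (hlog : ∀ t ∈ I, deriv (deriv (fun s => Real.log (f s))) t ≤ 0) :
    ¬ ∃ u : E2 → ℝ, ContDiff ℝ (⊤ : ℕ∞) u ∧ (∀ p, u p ∈ I) ∧ DoublyPeriodic u ∧
      (∀ p, ‖gradient u p‖ < f (u p)) ∧
      (∀ p, (Hmean f u p) ^ 2 < (deriv f (u p)) ^ 2 / (f (u p)) ^ 2) := by
  rintro ⟨u, hu, huI, hper, hgrad, hH⟩
  obtain ⟨⟨p, hpmin⟩, ⟨q, hqmax⟩⟩ := exists_ext hu.continuous hper
  have hfd : ∀ x, DifferentiableAt ℝ f (u x) := fun x =>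
    (hf.differentiableOn (by simp)).differentiableAt (hI.mem_nhds (huI x))
  have hgp : gradient u p = 0 := by
    have : fderiv ℝ u p = 0 := IsLocalMin.fderiv_eq_zero (Filter.Eventually.of_forall hpmin)
    simp [gradient, this]
  have hgq : gradient u q = 0 := by
    have : fderiv ℝ u q = 0 := IsLocalMax.fderiv_eq_zero (Filter.Eventually.of_forall hqmax)
    simp [gradient, this]
  have h1 : deriv f (u p) ≤ 0 := by
    by_contra hc
    push Not at hc
    have hP := hfpos _ (huI p)
    have h := hH p
    rw [← div_pow, Hmean_crit hu p (hfd p) hP hgp] at h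
    have hd : 0 ≤ divergence (gradient u) p / (2 * f (u p) ^ 2) :=
      div_nonneg (div_nonneg_of_min hu p hpmin) (by positivity)
    have : 0 < deriv f (u p) / f (u p) := div_pos hc hP
    nlinarith
  have h2 : 0 ≤ deriv f (u q) := by
    by_contra hc
    push Not at hc
    have hP := hfpos _ (huI q)
    have h := hH q
    rw [← div_pow, Hmean_crit hu q (hfd q) hP hgq] at h
    have hd : divergence (gradient u) q / (2 * f (u q) ^ 2) ≤ 0 :=
      div_nonpos_of_nonpos_of_nonneg (div_nonpos_of_max hu q hqmax) (by positivity)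
    have : deriv f (u q) / f (u q) < 0 := div_neg_of_neg_of_pos hc hP
    nlinarith
  have hcont : Continuous fun x => deriv f (u x) :=
    (hf.continuousOn_deriv_of_isOpen hI (by simp)).comp_continuous hu.continuous huI
  obtain ⟨x, hx⟩ := mem_range_of_exists_le_of_exists_ge hcont ⟨p, h1⟩ ⟨q, h2⟩
  have h := hH x
  simp only at hx
  rw [hx] at h
  have := sq_nonneg (Hmean f u x)
  simp at h
  linarith
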